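/- arXiv:1210.3117 — 7 statements merged into one kernel-verified Lean document; each statement's English description precedes it below -/
import Mathlib

section
/- Higman's Lemma: If (X, ≤) is a well-quasi-order, then the set X* of finite words over X, ordered by the word-embedding relation ≤*, is also a well-quasi-order; that is, for every infinite sequence of words u : ℕ → X* there exist indices i < j with u_i ≤* u_j. -/
/-- Word embedding: `a ≤* b` iff there is a strictly increasing map from the
positions of `a` to the positions of `b` which is pointwise `≤`. -/
def WordLE {X : Type*} [Preorder X] (a b : List X) : Prop :=
  ∃ f : Fin a.length → Fin b.length, StrictMono f ∧ ∀ i, a.get i ≤ b.get (f i)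

theorem WordLE.of_sublistForall₂ {X : Type*} [Preorder X] {a b : List X}
    (h : List.SublistForall₂ (· ≤ ·) a b) : WordLE a b := by
  obtain ⟨l, hal, hlb⟩ := List.sublistForall₂_iff.1 h
  obtain ⟨hlen, hle⟩ := List.forall₂_iff_get.1 hal
  obtain ⟨f, hf⟩ := List.sublist_iff_exists_fin_orderEmbedding_get_eq.1 hlb
  refine ⟨fun i => f (Fin.cast hlen i), fun i j hij => f.strictMono hij, fun i => ?_⟩
  rw [← hf]
  exact hle i i.isLt (hlen ▸ i.isLt)

/-- Higman's Lemma: if `X` is a WQO, then the words over `X` with the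
embedding relation form a WQO. -/
theorem higman_lemma {X : Type*} [Preorder X]
    (hwqo : ∀ x : ℕ → X, ∃ i j, i < j ∧ x i ≤ x j) :
    ∀ u : ℕ → List X, ∃ i j, i < j ∧ WordLE (u i) (u j) := by
  intro u
  have hX : (Set.univ : Set X).PartiallyWellOrderedOn (· ≤ ·) :=
    Set.partiallyWellOrderedOn_univ_iff.2 hwqo
  obtain ⟨i, j, hij, h⟩ :=
    (Set.PartiallyWellOrderedOn.partiallyWellOrderedOn_sublistForall₂ (· ≤ ·) hX).exists_lt
      (f := u) (fun _ _ _ => Set.mem_univ _)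
  exact ⟨i, j, hij, .of_sublistForall₂ h⟩
end

section
/- Existence of a minimal bad sequence: Suppose (X, ≤) is a preorder and there exists at least one bad sequence of words over X (with respect to the word-embedding relation ≤*). Then there exists a bad sequence v : ℕ → X* which is minimal in the following sense: for every n, there is no bad sequence q : ℕ → X* with q_i = v_i for all i < n and with q_n a proper prefix of v_n. -/
/-- A sequence of words is bad if no earlier word embeds into a later one. -/
def BadSeq {X : Type*} [Preorder X] (u : ℕ → List X) : Prop :=
  ∀ i j, i < j → ¬ WordLE (u i) (u j)

/-- `a` is a proper prefix of `b`: `|a| < |b|` and they agree on the first `|a|` letters. -/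
def ProperPrefix {X : Type*} (a b : List X) : Prop :=
  a.length < b.length ∧ a = b.take a.length

/-- Existence of a minimal bad sequence. -/
theorem exists_minimal_bad_sequence {X : Type*} [Preorder X]
    (h : ∃ u : ℕ → List X, BadSeq u) :
    ∃ v : ℕ → List X, BadSeq v ∧
      ∀ n : ℕ, ¬ ∃ q : ℕ → List X, BadSeq q ∧ (∀ i, i < n → q i = v i) ∧
        ProperPrefix (q n) (v n) := by
  obtain ⟨u, hu⟩ := h
  obtain ⟨v, hv, hmin⟩ :=
    Set.PartiallyWellOrderedOn.exists_min_bad_of_exists_bad WordLE List.length Set.univ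
      ⟨u, fun _ => Set.mem_univ _, hu⟩
  refine ⟨v, hv.2, ?_⟩
  rintro n ⟨q, hq, heq, hlt, -⟩
  exact hmin n q (fun i hi => (heq i hi).symm) hlt ⟨fun _ => Set.mem_univ _, hq⟩
end

section
/- One-step minimal choice (instance of the least element principle): Let (X, ≤) be a preorder. For every n : ℕ and every sequence of words w : ℕ → X*, there exist a sequence of words p : ℕ → X* and a function f : (ℕ → X*) → ℕ such that for all j : ℕ and all sequences q : ℕ → X*: (i) w_i = p_i for all i < n; (ii) θ(w, j) → θ(p, j); and (iii) if q ≺ₙ p then ¬θ(q, f(q)). -/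
/-- `θ(u, j)`: the sequence `u` is bad up to stage `j`. -/
def Theta {X : Type*} [Preorder X] (u : ℕ → List X) (j : ℕ) : Prop :=
  ∀ i₀ i₁, i₀ < i₁ → i₁ ≤ j → ¬ WordLE (u i₀) (u i₁)

/-- `u ≺ₙ v`: `u` agrees with `v` below `n` and `u n` is a proper prefix of `v n`. -/
def LexBelow {X : Type*} (n : ℕ) (u v : ℕ → List X) : Prop :=
  (∀ i, i < n → u i = v i) ∧ (u n).length < (v n).length ∧ u n = (v n).take (u n).length

/-- One-step minimal choice (instance of the least element principle). -/
theorem one_step_minimal_choice {X : Type*} [Preorder X]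
    (n : ℕ) (w : ℕ → List X) :
    ∃ (p : ℕ → List X) (f : (ℕ → List X) → ℕ),
      ∀ (j : ℕ) (q : ℕ → List X),
        (∀ i, i < n → w i = p i) ∧
        (Theta w j → Theta p j) ∧
        (LexBelow n q p → ¬ Theta q (f q)) := by
  let S : Set (ℕ → List X) := {p | (∀ i, i < n → w i = p i) ∧ ∀ j, Theta w j → Theta p j}
  have hS : S.Nonempty := ⟨w, fun _ _ => rfl, fun _ h => h⟩
  obtain ⟨p, ⟨hwp, hbad⟩, hmin⟩ :=
    (measure fun p : ℕ → List X => (p n).length).wf.has_min S hS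
  have hf : ∀ q, ∃ k, LexBelow n q p → ¬ Theta q k := by
    intro q
    by_contra! h
    exact hmin q ⟨fun i hi => (hwp i hi).trans ((h 0).1.1 i hi).symm, fun j _ => (h j).2⟩
      (h 0).1.2.1
  choose f hf using hf
  exact ⟨p, f, fun j q => ⟨hwp, hbad j, hf q⟩⟩
end

section
/- Minimal bad sequence construction (formalized): Let (X, ≤) be a preorder. For every sequence of words u : ℕ → X*, there exist a sequence p⁰, p¹, p², … of sequences of words (each pⁿ : ℕ → X*) and a sequence f⁰, f¹, f², … of functions (each fⁿ : (ℕ → X*) → ℕ) which, setting p⁻¹ := u, satisfy: (1) for all n, p^{n-1}_i = pⁿ_i for all i < n; (2) for all n and j, ¬θ(pⁿ, j) → ¬θ(p^{n-1}, j); and (3) for all n and all sequences q : ℕ → X*, if q ≺ₙ pⁿ then ¬θ(q, fⁿ(q)). -/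
/-- The family `pⁿ` extended by `p⁻¹ := u`: `prevSeq u p n` is `p^{n-1}`. -/
def prevSeq {X : Type*} (u : ℕ → List X) (p : ℕ → ℕ → List X) : ℕ → ℕ → List X
  | 0 => u
  | (n + 1) => p n

/-- Among the sequences agreeing with `v` below `n` and at least as bad as `v`, one whose `n`-th
word has minimal length has only good sequences lexicographically below it. -/
theorem exists_minimal_step {X : Type*} [Preorder X] (n : ℕ) (v : ℕ → List X) :
    ∃ w : ℕ → List X, (∀ i, i < n → v i = w i) ∧ (∀ j, ¬ Theta w j → ¬ Theta v j) ∧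
      ∀ q, LexBelow n q w → ∃ j, ¬ Theta q j := by
  let S : Set (ℕ → List X) :=
    {w | (∀ i, i < n → v i = w i) ∧ ∀ j, ¬ Theta w j → ¬ Theta v j}
  have hS : S.Nonempty := ⟨v, fun _ _ => rfl, fun _ h => h⟩
  obtain ⟨w, hw, hmin⟩ := (measure fun w : ℕ → List X => (w n).length).wf.has_min S hS
  refine ⟨w, hw.1, hw.2, fun q hq => ?_⟩
  by_contra! hbad
  exact hmin q ⟨fun i hi => (hw.1 i hi).trans (hq.1 i hi).symm,
    fun j hj => absurd (hbad j) hj⟩ hq.2.1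

/-- Minimal bad sequence construction, formalized. -/
theorem minimal_bad_sequence_construction {X : Type*} [Preorder X]
    (u : ℕ → List X) :
    ∃ (p : ℕ → ℕ → List X) (f : ℕ → (ℕ → List X) → ℕ),
      (∀ n, ∀ i, i < n → prevSeq u p n i = p n i) ∧
      (∀ n j, ¬ Theta (p n) j → ¬ Theta (prevSeq u p n) j) ∧
      (∀ n (q : ℕ → List X), LexBelow n q (p n) → ¬ Theta q (f n q)) := by
  choose step hagree hbad hmin using exists_minimal_step (X := X)
  let p : ℕ → ℕ → List X := fun n => Nat.rec (step 0 u) (fun k w => step (k + 1) w) n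
  have hp : ∀ n, p n = step n (prevSeq u p n) := by
    intro n
    cases n <;> rfl
  have hgood : ∀ n q, ∃ j, LexBelow n q (p n) → ¬ Theta q j := by
    intro n q
    by_cases h : LexBelow n q (p n)
    · have h' := h
      rw [hp n] at h'
      exact ⟨_, fun _ => (hmin n _ q h').choose_spec⟩
    · exact ⟨0, fun h' => absurd h' h⟩
  choose f hf using hgood
  refine ⟨p, f, fun n => ?_, fun n => ?_, hf⟩
  · rw [hp n]
    exact hagree n _
  · rw [hp n]
    exact hbad n _
end

section
/- Let (X, ≤) be a preorder. Suppose: (Ram) for every sequence x : ℕ → X there exists a strictly increasing g : ℕ → ℕ with x_{g(i)} ≤ x_{g(j)} for all i < j; and (MB) for every sequence of words u : ℕ → X* there exist sequences pⁿ : ℕ → X* (n ≥ 0) and functions fⁿ : (ℕ → X*) → ℕ which, setting p⁻¹ := u, satisfy (1) p^{n-1}_i = pⁿ_i for all i < n; (2) for all n, j: ¬θ(pⁿ, j) → ¬θ(p^{n-1}, j); and (3) for all n, q: q ≺ₙ pⁿ → ¬θ(q, fⁿ(q)). Then X* is a well-quasi-order: for every u : ℕ → X* there exist i < j with u_i ≤*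 u_j. -/
theorem wordLE_nil {X : Type*} [Preorder X] (b : List X) : WordLE [] b :=
  ⟨fun i => i.elim0, fun i => i.elim0, fun i => i.elim0⟩

theorem WordLE.append_right {X : Type*} [Preorder X] {a b : List X} (h : WordLE a b)
    (c : List X) : WordLE a (b ++ c) := by
  obtain ⟨f, hf, hle⟩ := h
  refine ⟨fun i => ⟨f i, by simp; omega⟩, fun i j hij => hf hij, fun i => ?_⟩
  simpa using hle i

theorem WordLE.concat {X : Type*} [Preorder X] {a b : List X} (h : WordLE a b)
    {x y : X} (hxy : x ≤ y) : WordLE (a ++ [x]) (b ++ [y]) := by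
  obtain ⟨f, hf, hle⟩ := h
  refine ⟨fun i => if hi : i.1 < a.length then ⟨f ⟨i, hi⟩, by simp⟩
    else ⟨b.length, by simp⟩, fun i j hij => ?_, fun i => ?_⟩
  · have hij' : i.1 < j.1 := hij
    have hj := j.2
    simp only [List.length_append, List.length_singleton] at hj
    have hi : i.1 < a.length := by omega
    by_cases hj' : j.1 < a.length
    · simp only [hi, hj', dif_pos]
      exact hf (a := ⟨i, hi⟩) (b := ⟨j, hj'⟩) hij'
    · simp [hi, hj', Fin.lt_def]
  · by_cases hi : i.1 < a.length
    · simpa [hi, List.getElem_append_left] using hle ⟨i, hi⟩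
    · simpa [hi, List.getElem_append_right (not_lt.1 hi)] using hxy

/-- If every sequence in `X` has a monotone subsequence, no bad sequence of words `v` is minimal,
in the sense that every sequence which agrees with `v` below some `n` and has a proper prefix of
`v n` at `n` is good. -/
theorem exists_lexBelow_theta {X : Type*} [Preorder X]
    (ram : ∀ x : ℕ → X, ∃ g : ℕ → ℕ, StrictMono g ∧ ∀ i j, i < j → x (g i) ≤ x (g j))
    {v : ℕ → List X} (hv : ∀ j, Theta v j) :
    ∃ n q, LexBelow n q v ∧ ∀ j, Theta q j := by
  have hbad : ∀ i j, i < j → ¬ WordLE (v i) (v j) := fun i j hij => hv j i j hij le_rfl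
  have hsplit : ∀ n, ∃ w x, v n = w ++ [x] := fun n => by
    rcases List.eq_nil_or_concat (v n) with h | ⟨w, x, h⟩
    · exact (hbad n (n + 1) n.lt_succ_self (h ▸ wordLE_nil _)).elim
    · exact ⟨w, x, by simpa using h⟩
  choose w x hwx using hsplit
  obtain ⟨g, hg, hmono⟩ := ram x
  refine ⟨g 0, fun i => if i < g 0 then v i else w (g (i - g 0)),
    ⟨fun i hi => if_pos hi, by simp [hwx (g 0)], by simp [hwx (g 0)]⟩, fun _ i j hij _ h => ?_⟩
  by_cases hj : j < g 0
  · simp only [hij.trans hj, hj, if_true] at h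
    exact hbad i j hij h
  by_cases hi : i < g 0
  · simp only [hi, hj, if_true, if_false] at h
    refine hbad i (g (j - g 0)) (hi.trans_le (hg.monotone (Nat.zero_le _))) ?_
    rw [hwx (g (j - g 0))]
    exact h.append_right _
  · simp only [hi, hj, if_false] at h
    have hlt : i - g 0 < j - g 0 := by omega
    refine hbad _ _ (hg hlt) ?_
    rw [hwx (g (i - g 0)), hwx (g (j - g 0))]
    exact h.concat (hmono _ _ hlt)

/-- In a family where `p n` and `p (n + 1)` agree up to `n`, each `p n` agrees with the diagonal
up to `n`. -/
theorem eq_diagonal_of_agree {X : Type*} {p : ℕ → ℕ → List X}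
    (h : ∀ n i, i < n + 1 → p n i = p (n + 1) i) {n i : ℕ} (hi : i ≤ n) : p n i = p i i := by
  induction n, hi using Nat.le_induction with
  | base => rfl
  | succ n hin ih => rw [← h n i (Nat.lt_succ_of_le hin), ih]

/-- Ram and the minimal bad sequence construction imply that `X*` is a WQO. -/
theorem ram_and_mbs_imp_wqo_words {X : Type*} [Preorder X]
    (ram : ∀ x : ℕ → X, ∃ g : ℕ → ℕ, StrictMono g ∧ ∀ i j, i < j → x (g i) ≤ x (g j))
    (mbs : ∀ u : ℕ → List X,
      ∃ (p : ℕ → ℕ → List X) (f : ℕ → (ℕ → List X) → ℕ),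
        (∀ n, ∀ i, i < n → prevSeq u p n i = p n i) ∧
        (∀ n j, ¬ Theta (p n) j → ¬ Theta (prevSeq u p n) j) ∧
        (∀ n (q : ℕ → List X), LexBelow n q (p n) → ¬ Theta q (f n q))) :
    ∀ u : ℕ → List X, ∃ i j, i < j ∧ WordLE (u i) (u j) := by
  intro u
  by_contra! hu
  obtain ⟨p, f, hagree, htheta, hmin⟩ := mbs u
  have hbad : ∀ n j, Theta (prevSeq u p n) j := fun n => by
    induction n with
    | zero => exact fun _ i j hij _ => hu i j hij
    | succ n ih => exact fun j => by_contra fun h => htheta n j h (ih j)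
  have hdiag : ∀ {n i}, i ≤ n → p n i = p i i :=
    eq_diagonal_of_agree fun n => hagree (n + 1)
  have hv : ∀ j, Theta (fun n => p n n) j := fun _ i j hij _ h =>
    hbad (j + 1) j i j hij le_rfl (by simpa [prevSeq, hdiag hij.le] using h)
  obtain ⟨n, q, ⟨hq, hlen, htake⟩, hqbad⟩ := exists_lexBelow_theta ram hv
  exact hmin n q ⟨fun i hi => (hq i hi).trans (hdiag hi.le).symm, hlen, htake⟩ (hqbad _)
end

section
/- If every sequence x : ℕ → X in the preorder (X, ≤) admits a strictly increasing g : ℕ → ℕ with x_{g(i)} ≤ x_{g(j)} for all i < j, then X* is a well-quasi-order: for every sequence of words u : ℕ → X* there exist i < j with u_i ≤* u_j. -/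
/-- If every sequence in `X` has an infinite increasing subsequence, then `X*`
is a well-quasi-order. -/
theorem ram_imp_wqo_words {X : Type*} [Preorder X]
    (ram : ∀ x : ℕ → X, ∃ g : ℕ → ℕ, StrictMono g ∧ ∀ i j, i < j → x (g i) ≤ x (g j)) :
    ∀ u : ℕ → List X, ∃ i j, i < j ∧ WordLE (u i) (u j) := by
  intro u
  have hX : (Set.univ : Set X).PartiallyWellOrderedOn (· ≤ ·) :=
    Set.partiallyWellOrderedOn_univ_iff.2 fun x =>
      let ⟨g, hg, hle⟩ := ram x
      ⟨g 0, g 1, hg zero_lt_one, hle 0 1 zero_lt_one⟩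
  obtain ⟨i, j, hij, h⟩ :=
    (hX.partiallyWellOrderedOn_sublistForall₂ (· ≤ ·)).exists_lt (f := u) fun _ _ _ =>
      Set.mem_univ _
  exact ⟨i, j, hij, .of_sublistForall₂ h⟩
end

section
/- No-counterexample interpretation of the one-step minimal choice: Let (X, ≤) be a preorder and write Y := (ℕ → X*) × ((ℕ → X*) → ℕ). For every n : ℕ, every sequence of words w : ℕ → X*, and all functionals J : Y → ℕ and Q : Y → (ℕ → X*), there exist p : ℕ → X* and f : (ℕ → X*) → ℕ such that: (i) w_i = p_i for all i < n; (ii) θ(w, J(p, f)) → θ(p, J(p, f)); and (iii) if Q(p, f) ≺ₙ p then ¬θ(Q(p, f), f(Q(p, f))). -/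
/-- If every `u ≺ₙ p` fails `Theta` at some stage, then a functional `f` finds such stages. -/
theorem exists_stage_functional {X : Type*} [Preorder X] {n : ℕ} {p : ℕ → List X}
    (h : ∀ u, LexBelow n u p → ∃ j, ¬ Theta u j) :
    ∃ f : (ℕ → List X) → ℕ, ∀ u, LexBelow n u p → ¬ Theta u (f u) := by
  choose! f hf using h
  exact ⟨f, hf⟩

/-- No-counterexample interpretation of the one-step minimal choice. -/
theorem nci_one_step_minimal_choice {X : Type*} [Preorder X]
    (n : ℕ) (w : ℕ → List X)
    (J : (ℕ → List X) × ((ℕ → List X) → ℕ) → ℕ)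
    (Q : (ℕ → List X) × ((ℕ → List X) → ℕ) → (ℕ → List X)) :
    ∃ (p : ℕ → List X) (f : (ℕ → List X) → ℕ),
      (∀ i, i < n → w i = p i) ∧
      (Theta w (J (p, f)) → Theta p (J (p, f))) ∧
      (LexBelow n (Q (p, f)) p → ¬ Theta (Q (p, f)) (f (Q (p, f)))) := by
  by_cases hbad : ∃ u : ℕ → List X, (∀ i, i < n → w i = u i) ∧ ∀ j, Theta u j
  · obtain ⟨p, ⟨hwp, hp⟩, hmin⟩ := exists_minimalFor_of_wellFoundedLT
      (fun u : ℕ → List X => (∀ i, i < n → w i = u i) ∧ ∀ j, Theta u j)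
      (fun u => (u n).length) hbad
    obtain ⟨f, hf⟩ := exists_stage_functional (n := n) (p := p) fun u hu => by
      by_contra! hall
      have hwu : ∀ i, i < n → w i = u i := fun i hi => (hwp i hi).trans (hu.1 i hi).symm
      exact absurd (hmin ⟨hwu, hall⟩ hu.2.1.le) (not_le.mpr hu.2.1)
    exact ⟨p, f, hwp, fun _ => hp _, hf _⟩
  · push Not at hbad
    obtain ⟨f, hf⟩ := exists_stage_functional (n := n) (p := w) fun u hu =>
      hbad u fun i hi => (hu.1 i hi).symm
    exact ⟨w, f, fun _ _ => rfl, id, hf _⟩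
end
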